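/- The contraction rule (from Γ,Π,Π ⇒ Δ infer Γ,Π ⇒ Δ for any finite multiset Π) is admissible in the sequent calculus Go_Seq: if the premise is provable in Go_Seq, so is the conclusion. -/

import Mathlib

inductive Formula : Type
  | atom : ℕ → Formula
  | bot  : Formula
  | imp  : Formula → Formula → Formula
  | box  : Formula → Formula
deriving DecidableEq

def boxtimes (Γ : Multiset Formula) : Multiset Formula := Γ + Γ.map Formula.box

inductive GoSeq : Bool → Multiset Formula → Multiset Formula → Prop
  | ax (c) (Γ Δ : Multiset Formula) (A : Formula) : GoSeq c (A ::ₘ Γ) (A ::ₘ Δ)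
  | axBot (c) (Γ Δ : Multiset Formula) : GoSeq c (Formula.bot ::ₘ Γ) Δ
  | impL (c) (Γ Δ : Multiset Formula) (A B : Formula) :
      GoSeq c (B ::ₘ Γ) Δ → GoSeq c Γ (A ::ₘ Δ) → GoSeq c ((A.imp B) ::ₘ Γ) Δ
  | impR (c) (Γ Δ : Multiset Formula) (A B : Formula) :
      GoSeq c (A ::ₘ Γ) (B ::ₘ Δ) → GoSeq c Γ ((A.imp B) ::ₘ Δ)
  | boxGo (c) (Γ Δ Θ : Multiset Formula) (A : Formula) :
      GoSeq c ((Formula.box (A.imp (Formula.box A))) ::ₘ boxtimes Θ) {A} →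
      GoSeq c (Γ + Θ.map Formula.box) ((Formula.box A) ::ₘ Δ)
  | cut (Γ Δ : Multiset Formula) (A : Formula) :
      GoSeq true Γ (A ::ₘ Δ) → GoSeq true (A ::ₘ Γ) Δ → GoSeq true Γ Δ


/-- The cut-free calculus with a height bound and with axioms restricted to non-implications, so
that the rules for implication are height-preserving invertible. -/
inductive BoundedSeq : ℕ → Multiset Formula → Multiset Formula → Prop
  | ax {n Γ Δ} (A : Formula) (hA : ∀ B C : Formula, A ≠ B.imp C) (hΓ : A ∈ Γ) (hΔ : A ∈ Δ) :
      BoundedSeq n Γ Δ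
  | axBot {n Γ Δ} (hΓ : Formula.bot ∈ Γ) : BoundedSeq n Γ Δ
  | impL {n Γ Δ} (Γ' : Multiset Formula) (A B : Formula) (hΓ : Γ = (A.imp B) ::ₘ Γ')
      (hB : BoundedSeq n (B ::ₘ Γ') Δ) (hA : BoundedSeq n Γ' (A ::ₘ Δ)) : BoundedSeq (n + 1) Γ Δ
  | impR {n Γ Δ} (Δ' : Multiset Formula) (A B : Formula) (hΔ : Δ = (A.imp B) ::ₘ Δ')
      (h : BoundedSeq n (A ::ₘ Γ) (B ::ₘ Δ')) : BoundedSeq (n + 1) Γ Δ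
  | boxGo {n Γ Δ} (Θ : Multiset Formula) (A : Formula) (hΓ : Θ.map Formula.box ≤ Γ)
      (hΔ : A.box ∈ Δ)
      (h : BoundedSeq n ((A.imp A.box).box ::ₘ boxtimes Θ) {A}) : BoundedSeq (n + 1) Γ Δ

namespace BoundedSeq

theorem succ {n : ℕ} {Γ Δ : Multiset Formula} (h : BoundedSeq n Γ Δ) :
    BoundedSeq (n + 1) Γ Δ := by
  induction h with
  | ax A hA hΓ hΔ => exact ax A hA hΓ hΔ
  | axBot hΓ => exact axBot hΓ
  | impL Γ' A B hΓ _ _ ihB ihA => exact impL Γ' A B hΓ ihB ihA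
  | impR Δ' A B hΔ _ ih => exact impR Δ' A B hΔ ih
  | boxGo Θ A hΓ hΔ _ ih => exact boxGo Θ A hΓ hΔ ih

theorem mono {m n : ℕ} {Γ Δ : Multiset Formula} (h : BoundedSeq m Γ Δ) (hmn : m ≤ n) :
    BoundedSeq n Γ Δ := by
  induction hmn with
  | refl => exact h
  | step _ ih => exact ih.succ

theorem map_box_le_of_le_imp_cons {Θ Γ : Multiset Formula} {A B : Formula}
    (h : Θ.map Formula.box ≤ (A.imp B) ::ₘ Γ) : Θ.map Formula.box ≤ Γ :=
  (Multiset.le_cons_of_notMem (by simp)).1 h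

theorem impL_inv {n : ℕ} {Γ Δ : Multiset Formula} {A B : Formula}
    (h : BoundedSeq n ((A.imp B) ::ₘ Γ) Δ) :
    BoundedSeq n (B ::ₘ Γ) Δ ∧ BoundedSeq n Γ (A ::ₘ Δ) := by
  induction n generalizing Γ Δ with
  | zero =>
    cases h with
    | ax C hC hΓ hΔ =>
      have hmem := (Multiset.mem_cons.1 hΓ).resolve_left (hC A B)
      exact ⟨ax C hC (by simp [hmem]) hΔ, ax C hC hmem (by simp [hΔ])⟩
    | axBot hΓ => exact ⟨axBot (by simp_all), axBot (by simp_all)⟩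
  | succ n ih =>
    cases h with
    | ax C hC hΓ hΔ =>
      have hmem := (Multiset.mem_cons.1 hΓ).resolve_left (hC A B)
      exact ⟨ax C hC (by simp [hmem]) hΔ, ax C hC hmem (by simp [hΔ])⟩
    | axBot hΓ => exact ⟨axBot (by simp_all), axBot (by simp_all)⟩
    | impL Γ' C D hΓ hD hC =>
      rcases Multiset.cons_eq_cons.1 hΓ with ⟨heq, rfl⟩ | ⟨_, Λ, rfl, rfl⟩
      · cases heq
        exact ⟨hD.succ, hC.succ⟩
      · rw [Multiset.cons_swap] at hD
        refine ⟨impL (B ::ₘ Λ) C D (Multiset.cons_swap _ _ _) ?_ (ih hC).1,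
          impL Λ C D rfl (ih hD).2 ?_⟩
        · rw [Multiset.cons_swap]
          exact (ih hD).1
        · rw [Multiset.cons_swap]
          exact (ih hC).2
    | impR Δ' C D hΔ h =>
      subst hΔ
      rw [Multiset.cons_swap] at h
      refine ⟨impR Δ' C D rfl ?_, impR (A ::ₘ Δ') C D (Multiset.cons_swap _ _ _) ?_⟩
      · rw [Multiset.cons_swap]
        exact (ih h).1
      · rw [Multiset.cons_swap]
        exact (ih h).2
    | boxGo Θ C hΓ hΔ h =>
      have hle := map_box_le_of_le_imp_cons hΓ
      exact ⟨boxGo Θ C (hle.trans (Multiset.le_cons_self _ _)) hΔ h,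
        boxGo Θ C hle (Multiset.mem_cons_of_mem hΔ) h⟩

theorem impR_inv {n : ℕ} {Γ Δ : Multiset Formula} {A B : Formula}
    (h : BoundedSeq n Γ ((A.imp B) ::ₘ Δ)) : BoundedSeq n (A ::ₘ Γ) (B ::ₘ Δ) := by
  induction n generalizing Γ Δ with
  | zero =>
    cases h with
    | ax C hC hΓ hΔ =>
      have hmem := (Multiset.mem_cons.1 hΔ).resolve_left (hC A B)
      exact ax C hC (by simp [hΓ]) (by simp [hmem])
    | axBot hΓ => exact axBot (by simp [hΓ])
  | succ n ih =>
    cases h with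
    | ax C hC hΓ hΔ =>
      have hmem := (Multiset.mem_cons.1 hΔ).resolve_left (hC A B)
      exact ax C hC (by simp [hΓ]) (by simp [hmem])
    | axBot hΓ => exact axBot (by simp [hΓ])
    | impL Γ' C D hΓ hD hC =>
      subst hΓ
      rw [Multiset.cons_swap] at hC
      refine impL (A ::ₘ Γ') C D (Multiset.cons_swap _ _ _) ?_ ?_
      · rw [Multiset.cons_swap]
        exact ih hD
      · rw [Multiset.cons_swap]
        exact ih hC
    | impR Δ' C D hΔ h =>
      rcases Multiset.cons_eq_cons.1 hΔ with ⟨heq, rfl⟩ | ⟨_, Λ, rfl, rfl⟩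
      · cases heq
        exact h.succ
      · rw [Multiset.cons_swap] at h
        refine impR (B ::ₘ Λ) C D (Multiset.cons_swap _ _ _) ?_
        rw [Multiset.cons_swap, Multiset.cons_swap D]
        exact ih h
    | boxGo Θ C hΓ hΔ h =>
      exact boxGo Θ C (hΓ.trans (Multiset.le_cons_self _ _)) (by simp_all) h

theorem boxtimes_cons (A : Formula) (Θ : Multiset Formula) :
    boxtimes (A ::ₘ Θ) = A ::ₘ A.box ::ₘ boxtimes Θ := by
  simp [boxtimes, Multiset.cons_swap]

theorem contraction {n : ℕ} :
    (∀ {Γ Δ D}, BoundedSeq n (D ::ₘ D ::ₘ Γ) Δ → BoundedSeq n (D ::ₘ Γ) Δ) ∧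
      ∀ {Γ Δ D}, BoundedSeq n Γ (D ::ₘ D ::ₘ Δ) → BoundedSeq n Γ (D ::ₘ Δ) := by
  induction n with
  | zero =>
    constructor
    all_goals
      intro Γ Δ D h
      cases h with
      | ax C hC hΓ hΔ => exact ax C hC (by simpa using hΓ) (by simpa using hΔ)
      | axBot hΓ => exact axBot (by simpa using hΓ)
  | succ n ih =>
    obtain ⟨ihL, ihR⟩ := ih
    constructor
    · intro Γ Δ D h
      cases h with
      | ax C hC hΓ hΔ => exact ax C hC (by simpa using hΓ) hΔ
      | axBot hΓ => exact axBot (by simpa using hΓ)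
      | impL Γ' A B hΓ hB hA =>
        rcases Multiset.cons_eq_cons.1 hΓ with ⟨rfl, rfl⟩ | ⟨hne, Λ, hΛ, rfl⟩
        · rw [Multiset.cons_swap] at hB
          exact impL Γ A B rfl (ihL hB.impL_inv.1) (ihR hA.impL_inv.2)
        · obtain ⟨heq, -⟩ | ⟨-, Λ₁, rfl, rfl⟩ := Multiset.cons_eq_cons.1 hΛ
          · exact absurd heq hne
          · refine impL (D ::ₘ Λ₁) A B (Multiset.cons_swap _ _ _) ?_ (ihL hA)
            rw [Multiset.cons_swap]
            refine ihL ?_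
            rwa [Multiset.cons_swap D B, Multiset.cons_swap D B]
      | impR Δ' A B hΔ h =>
        refine impR Δ' A B hΔ ?_
        rw [Multiset.cons_swap]
        refine ihL ?_
        rwa [Multiset.cons_swap D A, Multiset.cons_swap D A]
      | boxGo Θ A hΓ hΔ h =>
        by_cases hD : D ∈ Θ.map Formula.box
        · obtain ⟨C, hC, rfl⟩ := Multiset.mem_map.1 hD
          obtain ⟨Θ₁, rfl⟩ := Multiset.exists_cons_of_mem hC
          rw [Multiset.map_cons, Multiset.cons_le_cons_iff] at hΓ
          by_cases hD₁ : C.box ∈ Θ₁.map Formula.box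
          · obtain ⟨C', hC', heq⟩ := Multiset.mem_map.1 hD₁
            cases heq
            obtain ⟨Θ₂, rfl⟩ := Multiset.exists_cons_of_mem hC'
            refine boxGo (C ::ₘ Θ₂) A (by simpa using hΓ) hΔ ?_
            have hperm : (A.imp A.box).box ::ₘ boxtimes (C ::ₘ C ::ₘ Θ₂) =
                C ::ₘ C ::ₘ C.box ::ₘ C.box ::ₘ (A.imp A.box).box ::ₘ boxtimes Θ₂ := by
              simp only [boxtimes_cons]
              simp only [← Multiset.singleton_add]
              abel
            have hperm' : (A.imp A.box).box ::ₘ boxtimes (C ::ₘ Θ₂) =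
                C.box ::ₘ C ::ₘ (A.imp A.box).box ::ₘ boxtimes Θ₂ := by
              simp only [boxtimes_cons]
              simp only [← Multiset.singleton_add]
              abel
            rw [hperm] at h
            rw [hperm']
            have h' := ihL h
            rw [Multiset.cons_swap C, Multiset.cons_swap C] at h'
            exact ihL h'
          · refine boxGo (C ::ₘ Θ₁) A ?_ hΔ h
            rw [Multiset.map_cons, Multiset.cons_le_cons_iff]
            exact (Multiset.le_cons_of_notMem hD₁).1 hΓ
        · exact boxGo Θ A ((Multiset.le_cons_of_notMem hD).1 hΓ) hΔ h
    · intro Γ Δ D h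
      cases h with
      | ax C hC hΓ hΔ => exact ax C hC hΓ (by simpa using hΔ)
      | axBot hΓ => exact axBot hΓ
      | impL Γ' A B hΓ hB hA =>
        refine impL Γ' A B hΓ (ihR hB) ?_
        rw [Multiset.cons_swap]
        refine ihR ?_
        rwa [Multiset.cons_swap D A, Multiset.cons_swap D A]
      | impR Δ' A B hΔ h =>
        rcases Multiset.cons_eq_cons.1 hΔ with ⟨rfl, rfl⟩ | ⟨hne, Λ, hΛ, rfl⟩
        · rw [Multiset.cons_swap] at h
          exact impR Δ A B rfl (ihL (ihR h.impR_inv))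
        · obtain ⟨heq, -⟩ | ⟨-, Λ₁, rfl, rfl⟩ := Multiset.cons_eq_cons.1 hΛ
          · exact absurd heq hne
          · refine impR (D ::ₘ Λ₁) A B (Multiset.cons_swap _ _ _) ?_
            rw [Multiset.cons_swap]
            refine ihR ?_
            rwa [Multiset.cons_swap D B, Multiset.cons_swap D B]
      | boxGo Θ A hΓ hΔ h => exact boxGo Θ A hΓ (by simpa using hΔ) h

theorem exists_ax (A : Formula) (Γ Δ : Multiset Formula) :
    ∃ n, BoundedSeq n (A ::ₘ Γ) (A ::ₘ Δ) := by
  induction A generalizing Γ Δ with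
  | atom p => exact ⟨0, ax (.atom p) (by simp) (by simp) (by simp)⟩
  | bot => exact ⟨0, axBot (by simp)⟩
  | box A _ => exact ⟨0, ax A.box (by simp) (by simp) (by simp)⟩
  | imp A B ihA ihB =>
    obtain ⟨m, hm⟩ := ihA Γ (B ::ₘ Δ)
    obtain ⟨n, hn⟩ := ihB (A ::ₘ Γ) Δ
    exact ⟨max m n + 2, impR Δ A B rfl (impL (A ::ₘ Γ) A B (Multiset.cons_swap _ _ _)
      (hn.mono (le_max_right _ _)) (hm.mono (le_max_left _ _)))⟩

theorem exists_of_goSeq {c : Bool} {Γ Δ : Multiset Formula} (h : GoSeq c Γ Δ) (hc : c = false) :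
    ∃ n, BoundedSeq n Γ Δ := by
  induction h with
  | ax c Γ Δ A => exact exists_ax A Γ Δ
  | axBot c Γ Δ => exact ⟨0, axBot (by simp)⟩
  | impL c Γ Δ A B _ _ ihB ihA =>
    obtain ⟨m, hm⟩ := ihB hc
    obtain ⟨n, hn⟩ := ihA hc
    exact ⟨max m n + 1,
      impL Γ A B rfl (hm.mono (le_max_left _ _)) (hn.mono (le_max_right _ _))⟩
  | impR c Γ Δ A B _ ih =>
    obtain ⟨n, hn⟩ := ih hc
    exact ⟨n + 1, impR Δ A B rfl hn⟩
  | boxGo c Γ Δ Θ A _ ih =>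
    obtain ⟨n, hn⟩ := ih hc
    exact ⟨n + 1, boxGo Θ A (Multiset.le_add_left _ _) (by simp) hn⟩
  | cut => cases hc

theorem goSeq {n : ℕ} {Γ Δ : Multiset Formula} (h : BoundedSeq n Γ Δ) (c : Bool) :
    GoSeq c Γ Δ := by
  induction h with
  | ax A _ hΓ hΔ =>
    obtain ⟨Γ, rfl⟩ := Multiset.exists_cons_of_mem hΓ
    obtain ⟨Δ, rfl⟩ := Multiset.exists_cons_of_mem hΔ
    exact GoSeq.ax c Γ Δ A
  | axBot hΓ =>
    obtain ⟨Γ, rfl⟩ := Multiset.exists_cons_of_mem hΓ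
    exact GoSeq.axBot c Γ _
  | impL Γ' A B hΓ _ _ ihB ihA =>
    subst hΓ
    exact GoSeq.impL c Γ' _ A B ihB ihA
  | impR Δ' A B hΔ _ ih =>
    subst hΔ
    exact GoSeq.impR c _ Δ' A B ih
  | boxGo Θ A hΓ hΔ _ ih =>
    obtain ⟨Γ, rfl⟩ := Multiset.le_iff_exists_add.1 hΓ
    obtain ⟨Δ, rfl⟩ := Multiset.exists_cons_of_mem hΔ
    rw [add_comm]
    exact GoSeq.boxGo c Γ Δ Θ A ih

theorem contraction_add {n : ℕ} {Γ Θ Δ : Multiset Formula} (h : BoundedSeq n (Γ + Θ + Θ) Δ) :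
    BoundedSeq n (Γ + Θ) Δ := by
  induction Θ using Multiset.induction generalizing Γ with
  | empty => simpa using h
  | cons A Θ ih =>
    have hperm : Γ + A ::ₘ Θ + A ::ₘ Θ = A ::ₘ A ::ₘ (Γ + Θ + Θ) := by
      simp only [← Multiset.singleton_add]
      abel
    rw [hperm] at h
    have h' := contraction.1 h
    rw [← Multiset.cons_add, ← Multiset.cons_add] at h'
    rw [Multiset.add_cons, ← Multiset.cons_add]
    exact ih h'

end BoundedSeq

theorem stmt5 (Γ Θ Δ : Multiset Formula) :
    GoSeq false (Γ + Θ + Θ) Δ → GoSeq false (Γ + Θ) Δ := by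
  intro h
  obtain ⟨n, hn⟩ := BoundedSeq.exists_of_goSeq h rfl
  exact hn.contraction_add.goSeq false
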